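/- Let R > 0 and let f^in : ℝ³×ℝ³ → [0,∞) be bounded and measurable with support contained in {(y,p) : |y| ≤ R, |p| ≤ R}. Then there is a constant C > 0 depending only on R and ‖f^in‖_∞ such that for all t > 0 and all x ∈ ℝ³, with ω := −(x−y)/|x−y| and p̂ := p/√(1+|p|²), (1/t)∫_{|x−y|=t} ∫_{ℝ³} f^in(y,p)/((1+ω·p̂)√(1+|p|²)) dp dS_y ≤ C(1+t)^{-1}; moreover this integral vanishes whenever |x| < t − R. -/

import Mathlib

open MeasureTheory Real Filter
open scoped RealInnerProductSpace ENNReal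

noncomputable section

/-- Physical/momentum space `ℝ³`, modelled as Euclidean space. -/
abbrev E3 := EuclideanSpace ℝ (Fin 3)

/-- `p̂ := p / √(1+|p|²)`. -/
def phat (p : E3) : E3 := (Real.sqrt (1 + ‖p‖ ^ 2))⁻¹ • p

/-- The `i`-th standard basis vector of `ℝ³`. -/
def e3 (i : Fin 3) : E3 := EuclideanSpace.single i 1

/-- Time derivative `∂ₜφ` of a field `φ(t,x)`. -/
def dt (φ : ℝ → E3 → ℝ) (t : ℝ) (x : E3) : ℝ := deriv (fun s => φ s x) t

/-- Second time derivative `∂ₜ²φ`. -/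
def dtt (φ : ℝ → E3 → ℝ) (t : ℝ) (x : E3) : ℝ := deriv (fun s => dt φ s x) t

/-- Spatial gradient `∇ₓφ`. -/
def gradx (φ : ℝ → E3 → ℝ) (t : ℝ) (x : E3) : E3 := gradient (φ t) x

/-- Spatial Laplacian `Δₓφ`. -/
def lapx (φ : ℝ → E3 → ℝ) (t : ℝ) (x : E3) : ℝ :=
  ∑ i : Fin 3, fderiv ℝ (fun x' => fderiv ℝ (φ t) x' (e3 i)) x (e3 i)

/-- The transport operator `S = ∂ₜ + p̂·∇ₓ` applied to a field `φ(t,x)`. -/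
def Sphi (φ : ℝ → E3 → ℝ) (p : E3) (t : ℝ) (x : E3) : ℝ :=
  dt φ t x + ⟪phat p, gradx φ t x⟫

/-- The transport operator `S = ∂ₜ + p̂·∇ₓ` applied to a density `f(t,x,p)`. -/
def Sf (f : ℝ → E3 → E3 → ℝ) (t : ℝ) (x : E3) (p : E3) : ℝ :=
  deriv (fun s => f s x p) t + ⟪phat p, gradient (fun x' => f t x' p) x⟫

/-- Divergence in the momentum variable `p` of a vector field on `ℝ³`. -/
def divP (V : E3 → E3) (p : E3) : ℝ :=
  ∑ i : Fin 3, fderiv ℝ (fun q => V q i) p (e3 i)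

/-- The vector field `G(t,x,p) = (Sφ)(t,x,p)·p + (1+|p|²)^{-1/2}·∇ₓφ(t,x)`. -/
def Gfield (φ : ℝ → E3 → ℝ) (t : ℝ) (x : E3) (q : E3) : E3 :=
  Sphi φ q t x • q + (Real.sqrt (1 + ‖q‖ ^ 2))⁻¹ • gradx φ t x

/-- `K(t,x) = |∂ₜφ(t,x)| + |∇ₓφ(t,x)|`: the size of the first-order derivatives. -/
def Kfun (φ : ℝ → E3 → ℝ) (t : ℝ) (x : E3) : ℝ := |dt φ t x| + ‖gradx φ t x‖

/-- `L(t,x)`: the sum of the absolute values of all second-order derivatives of `φ`. -/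
def Lfun (φ : ℝ → E3 → ℝ) (t : ℝ) (x : E3) : ℝ :=
  |dtt φ t x|
    + ∑ i : Fin 3, |deriv (fun s => fderiv ℝ (φ s) x (e3 i)) t|
    + ∑ i : Fin 3, ∑ j : Fin 3, |fderiv ℝ (fun x' => fderiv ℝ (φ t) x' (e3 i)) x (e3 j)|

/-- On the part of a sphere centred at `x` where the coordinate `i` of `y - x` dominates with a
fixed sign `s`, dropping that coordinate is antilipschitz. -/
lemma dist_le_of_mem_sphere_of_dominant_coord {x y z : E3} {t s : ℝ} (ht : 0 < t) (hs : |s| = 1)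
    {i : Fin 3} (hy : y ∈ Metric.sphere x t) (hz : z ∈ Metric.sphere x t)
    (hyi : ∀ j, |y j - x j| ≤ s * (y i - x i)) (hzi : ∀ j, |z j - x j| ≤ s * (z i - x i)) :
    dist y z ≤ 4 * dist (fun k => y (i.succAbove k)) (fun k => z (i.succAbove k)) := by
  set d := dist (fun k => y (i.succAbove k)) (fun k => z (i.succAbove k)) with hd
  have hd0 : 0 ≤ d := dist_nonneg
  have hk : ∀ k, |y (i.succAbove k) - z (i.succAbove k)| ≤ d := fun k => by
    rw [← Real.dist_eq]
    exact dist_le_pi_dist (fun k => y (i.succAbove k)) (fun k => z (i.succAbove k)) k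
  clear_value d
  rw [Metric.mem_sphere, EuclideanSpace.dist_eq] at hy hz
  rw [EuclideanSpace.dist_eq]
  have hy2 := congrArg (· ^ 2) hy
  have hz2 := congrArg (· ^ 2) hz
  simp only [Real.dist_eq, sq_abs] at hy2 hz2 ⊢
  rw [Real.sq_sqrt (by positivity), Fin.sum_univ_succAbove _ i, Fin.sum_univ_two] at hy2 hz2
  rw [Fin.sum_univ_succAbove _ i, Fin.sum_univ_two]
  have h0 := hk 0
  have h1 := hk 1
  have hy0 := hyi (i.succAbove 0)
  have hy1 := hyi (i.succAbove 1)
  have hz0 := hzi (i.succAbove 0)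
  have hz1 := hzi (i.succAbove 1)
  have hyp : 0 < s * (y i - x i) := by
    by_contra! h
    have e0 := abs_nonpos_iff.1 (hy0.trans h)
    have e1 := abs_nonpos_iff.1 (hy1.trans h)
    have e2 := abs_nonpos_iff.1 ((hyi i).trans h)
    rw [e0, e1, e2] at hy2
    nlinarith
  have hzp : 0 ≤ s * (z i - x i) := (abs_nonneg _).trans (hzi i)
  have hsum : |y i - z i| * |(y i - x i) + (z i - x i)|
      ≤ 2 * d * (s * (y i - x i) + s * (z i - x i)) := by
    have e : (y i - z i) * ((y i - x i) + (z i - x i))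
        = -((y (i.succAbove 0) - z (i.succAbove 0))
              * ((y (i.succAbove 0) - x (i.succAbove 0)) + (z (i.succAbove 0) - x (i.succAbove 0)))
          + (y (i.succAbove 1) - z (i.succAbove 1))
              * ((y (i.succAbove 1) - x (i.succAbove 1))
                + (z (i.succAbove 1) - x (i.succAbove 1)))) := by
      linarith
    rw [← abs_mul, e, abs_neg]
    refine (abs_add_le _ _).trans ?_
    rw [abs_mul, abs_mul]
    have a0 := mul_le_mul h0 ((abs_add_le _ _).trans (add_le_add hy0 hz0)) (abs_nonneg _) hd0
    have a1 := mul_le_mul h1 ((abs_add_le _ _).trans (add_le_add hy1 hz1)) (abs_nonneg _) hd0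
    linarith
  have hsle : s * (y i - x i) + s * (z i - x i) ≤ |(y i - x i) + (z i - x i)| := by
    rw [← mul_add, ← one_mul |_|, ← hs, ← abs_mul]
    exact le_abs_self _
  have hi : |y i - z i| ≤ 2 * d :=
    le_of_mul_le_mul_right
      (hsum.trans (mul_le_mul_of_nonneg_left hsle (by positivity))) (by linarith)
  refine Real.sqrt_le_iff.2 ⟨by positivity, ?_⟩
  have q := sq_le_sq.2 (hi.trans (le_abs_self _))
  have q0 := sq_le_sq.2 (h0.trans (le_abs_self _))
  have q1 := sq_le_sq.2 (h1.trans (le_abs_self _))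
  nlinarith

/-- The part of a sphere around `x` on which a given signed coordinate of `y - x` dominates meets
a ball of radius `r` in a set of area `O(r ^ 2)`. -/
lemma hausdorffMeasure_sphere_dominant_inter_closedBall_le {t s r : ℝ} (ht : 0 < t) (hs : |s| = 1)
    (hr : 0 ≤ r) (x c : E3) (i : Fin 3) :
    μH[2] {y : E3 | (y ∈ Metric.sphere x t ∧ ∀ j, |y j - x j| ≤ s * (y i - x i)) ∧
      y ∈ Metric.closedBall c r} ≤ ENNReal.ofReal (64 * r ^ 2) := by
  set P := {y : E3 | (y ∈ Metric.sphere x t ∧ ∀ j, |y j - x j| ≤ s * (y i - x i)) ∧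
      y ∈ Metric.closedBall c r}
  let f : P → (Fin 2 → ℝ) := fun y k => (y : E3) (i.succAbove k)
  have hf : AntilipschitzWith 4 f := AntilipschitzWith.of_le_mul_dist fun y z =>
    dist_le_of_mem_sphere_of_dominant_coord ht hs y.2.1.1 z.2.1.1 y.2.1.2 z.2.1.2
  have himg : f '' Set.univ ⊆ Metric.closedBall (fun k => c (i.succAbove k)) r := by
    rintro _ ⟨y, -, rfl⟩
    refine (dist_pi_le_iff hr).2 fun k => ?_
    have h := PiLp.norm_apply_le ((y : E3) - c) (i.succAbove k)
    rw [← dist_eq_norm] at h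
    exact h.trans y.2.2
  have hvol : (μH[2] : Measure (Fin 2 → ℝ)) = volume := by
    simpa using hausdorffMeasure_pi_real (ι := Fin 2)
  calc μH[2] P = μH[2] (Set.univ : Set P) := by
        have h : Isometry (Subtype.val : P → E3) := isometry_subtype_coe
        rw [← h.hausdorffMeasure_image (Or.inl zero_le_two), Set.image_univ, Subtype.range_coe]
    _ ≤ ((4 : NNReal) : ℝ≥0∞) ^ (2 : ℝ) * μH[2] (f '' Set.univ) :=
        hf.le_hausdorffMeasure_image zero_le_two _
    _ ≤ ((4 : NNReal) : ℝ≥0∞) ^ (2 : ℝ)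
          * μH[2] (Metric.closedBall (fun k : Fin 2 => c (i.succAbove k)) r) := by gcongr
    _ = ENNReal.ofReal (64 * r ^ 2) := by
        rw [hvol, Real.volume_pi_closedBall _ hr]
        have : ((4 : NNReal) : ℝ≥0∞) ^ (2 : ℝ) = ENNReal.ofReal 16 := by
          rw [ENNReal.rpow_two]
          norm_num
        rw [this, ← ENNReal.ofReal_mul (by norm_num)]
        congr 1
        rw [Fintype.card_fin]
        ring

/-- A sphere meets a ball of radius `r` in a set of area `O(r ^ 2)`, uniformly in the sphere. -/
lemma hausdorffMeasure_sphere_inter_closedBall_le {t r : ℝ} (ht : 0 < t) (hr : 0 ≤ r)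
    (x c : E3) :
    μH[2] (Metric.sphere x t ∩ Metric.closedBall c r) ≤ ENNReal.ofReal (384 * r ^ 2) := by
  let P : ℝ → Fin 3 → Set E3 := fun s i =>
    {y : E3 | (y ∈ Metric.sphere x t ∧ ∀ j, |y j - x j| ≤ s * (y i - x i)) ∧
      y ∈ Metric.closedBall c r}
  have hcover : Metric.sphere x t ∩ Metric.closedBall c r ⊆ ⋃ i, (P 1 i ∪ P (-1) i) := by
    rintro y ⟨hy, hyc⟩
    obtain ⟨i, hi⟩ := Finite.exists_max fun j => |y j - x j|
    refine Set.mem_iUnion.2 ⟨i, ?_⟩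
    rcases abs_choice (y i - x i) with h | h
    · exact Or.inl ⟨⟨hy, fun j => (hi j).trans (by rw [h, one_mul])⟩, hyc⟩
    · exact Or.inr ⟨⟨hy, fun j => (hi j).trans (by rw [h, neg_one_mul])⟩, hyc⟩
  have hP : ∀ i, μH[2] (P 1 i ∪ P (-1) i) ≤ ENNReal.ofReal (128 * r ^ 2) := fun i => by
    refine (measure_union_le _ _).trans ((add_le_add
      (hausdorffMeasure_sphere_dominant_inter_closedBall_le ht (by simp) hr x c i)
      (hausdorffMeasure_sphere_dominant_inter_closedBall_le ht (by simp) hr x c i)).trans ?_)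
    rw [← ENNReal.ofReal_add (by positivity) (by positivity)]
    exact ENNReal.ofReal_le_ofReal (by linarith)
  calc μH[2] (Metric.sphere x t ∩ Metric.closedBall c r)
      ≤ ∑ i, μH[2] (P 1 i ∪ P (-1) i) := (measure_mono hcover).trans (measure_iUnion_fintype_le _ _)
    _ ≤ ∑ _i : Fin 3, ENNReal.ofReal (128 * r ^ 2) := Finset.sum_le_sum fun i _ => hP i
    _ = ENNReal.ofReal (384 * r ^ 2) := by
        rw [Fin.sum_univ_three, ← ENNReal.ofReal_add (by positivity) (by positivity),
          ← ENNReal.ofReal_add (by positivity) (by positivity)]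
        congr 1
        ring

/-- For `|ω| ≤ 1` and `|p| ≤ R` the kernel `(1 + ω·p̂) √(1 + |p|²)` is bounded away from zero. -/
lemma inv_le_one_add_inner_phat_mul_sqrt {ω p : E3} {R : ℝ} (hω : ‖ω‖ ≤ 1) (hp : ‖p‖ ≤ R) :
    (1 + 2 * R)⁻¹ ≤ (1 + ⟪ω, phat p⟫) * Real.sqrt (1 + ‖p‖ ^ 2) := by
  have hp0 := norm_nonneg p
  have hs2 : Real.sqrt (1 + ‖p‖ ^ 2) ^ 2 = 1 + ‖p‖ ^ 2 := Real.sq_sqrt (by positivity)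
  have hs0 : 0 < Real.sqrt (1 + ‖p‖ ^ 2) := Real.sqrt_pos.2 (by positivity)
  have hin : -‖p‖ ≤ ⟪ω, p⟫ := by
    have h1 := neg_le_of_abs_le (abs_real_inner_le_norm ω p)
    nlinarith
  have e : (1 + ⟪ω, phat p⟫) * Real.sqrt (1 + ‖p‖ ^ 2) = Real.sqrt (1 + ‖p‖ ^ 2) + ⟪ω, p⟫ := by
    rw [phat, real_inner_smul_right]
    field_simp
  rw [e]
  set s := Real.sqrt (1 + ‖p‖ ^ 2)
  have hs1 : s ≤ 1 + ‖p‖ := by nlinarith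
  have hsp : ‖p‖ < s := by nlinarith
  rw [inv_le_iff_one_le_mul₀ (by linarith)]
  have : (s - ‖p‖) * (s + ‖p‖) = 1 := by linarith
  nlinarith [mul_le_mul_of_nonneg_left (show s + ‖p‖ ≤ 1 + 2 * R by linarith) (sub_nonneg.2 hsp.le)]

/-- The momentum integral of a bounded, compactly supported density against the kernel of the
wave representation formula is bounded. -/
lemma norm_integral_div_kernel_le {R B : ℝ} {g : E3 → ℝ} {ω : E3} (hω : ‖ω‖ ≤ 1)
    (hg0 : ∀ p, 0 ≤ g p) (hgB : ∀ p, g p ≤ B) (hg : ∀ p, g p ≠ 0 → ‖p‖ ≤ R) :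
    ‖∫ p : E3, g p / ((1 + ⟪ω, phat p⟫) * Real.sqrt (1 + ‖p‖ ^ 2))‖
      ≤ B * (1 + 2 * R) * volume.real (Metric.closedBall (0 : E3) R) := by
  rw [← setIntegral_eq_integral_of_forall_compl_eq_zero (s := Metric.closedBall (0 : E3) R)]
  · refine norm_setIntegral_le_of_norm_le_const measure_closedBall_lt_top fun p hp => ?_
    rw [mem_closedBall_zero_iff] at hp
    have hR : 0 < 1 + 2 * R := by linarith [norm_nonneg p]
    have hk := inv_le_one_add_inner_phat_mul_sqrt hω hp
    have hk0 := (inv_pos.2 hR).trans_le hk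
    rw [Real.norm_of_nonneg (div_nonneg (hg0 p) hk0.le), div_eq_mul_inv]
    exact mul_le_mul (hgB p) (inv_le_of_inv_le₀ hR hk) (inv_pos.2 hk0).le
      ((hg0 p).trans (hgB p))
  · intro p hp
    rw [mem_closedBall_zero_iff] at hp
    rw [not_imp_comm.1 (hg p) hp, zero_div]

/-- there is a constant `C > 0`, depending only on `R` and the bound
`B` for `f^in`, such that for all `t > 0` and `x ∈ ℝ³`, with `ω = −(x−y)/|x−y|`,
`(1/t)∫_{|x−y|=t}∫ f^in(y,p)/((1+ω·p̂)√(1+|p|²)) dp dS_y ≤ C(1+t)⁻¹`,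
and moreover this integral vanishes whenever `|x| < t − R`.  The surface integral is
with respect to the 2-dimensional Hausdorff measure on the sphere `{y : |x−y| = t}`. -/
theorem stmt12 (R B : ℝ) (hR : 0 < R) (hB : 0 < B) :
    ∃ C : ℝ, 0 < C ∧
      ∀ fin : E3 → E3 → ℝ,
        Measurable (fun q : E3 × E3 => fin q.1 q.2) →
        (∀ (y p : E3), 0 ≤ fin y p) →
        (∀ (y p : E3), fin y p ≤ B) →
        (∀ (y p : E3), fin y p ≠ 0 → ‖y‖ ≤ R ∧ ‖p‖ ≤ R) →
        ∀ t : ℝ, 0 < t → ∀ x : E3,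
          (1 / t) * (∫ y in Metric.sphere x t,
              (∫ p : E3, fin y p /
                ((1 + ⟪‖x - y‖⁻¹ • (y - x), phat p⟫) * Real.sqrt (1 + ‖p‖ ^ 2))) ∂μH[2])
            ≤ C * (1 + t)⁻¹ ∧
          (‖x‖ < t - R →
            (1 / t) * (∫ y in Metric.sphere x t,
              (∫ p : E3, fin y p /
                ((1 + ⟪‖x - y‖⁻¹ • (y - x), phat p⟫) * Real.sqrt (1 + ‖p‖ ^ 2))) ∂μH[2])
              = 0) := by
  set V := volume.real (Metric.closedBall (0 : E3) R)
  have hV : 0 ≤ V := measureReal_nonneg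
  set M := B * (1 + 2 * R) * V with hM
  have hM0 : 0 ≤ M := by positivity
  refine ⟨384 * (M + 1) * (R + R ^ 2), by positivity, ?_⟩
  intro fin _ h0 hb hsupp t ht x
  set G : E3 → ℝ := fun y => ∫ p : E3, fin y p /
    ((1 + ⟪‖x - y‖⁻¹ • (y - x), phat p⟫) * Real.sqrt (1 + ‖p‖ ^ 2)) with hG
  have hGM : ∀ y, ‖G y‖ ≤ M := fun y =>
    norm_integral_div_kernel_le
      (by rw [norm_smul, norm_inv, norm_norm, norm_sub_rev y x]; exact inv_mul_le_one)
      (h0 y) (hb y) fun p hp => (hsupp y p hp).2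
  have hGz : ∀ y, R < ‖y‖ → G y = 0 := fun y hy => by
    have : ∀ p, fin y p = 0 := fun p => by
      by_contra h
      exact (hsupp y p h).1.not_gt hy
    simp [hG, this]
  constructor
  · set S := Metric.sphere x t ∩ Metric.closedBall (0 : E3) R
    have hSR : μH[2] S ≤ ENNReal.ofReal (384 * R ^ 2) :=
      hausdorffMeasure_sphere_inter_closedBall_le ht hR.le x 0
    have hSt : μH[2] S ≤ ENNReal.ofReal (384 * t ^ 2) :=
      (measure_mono (Set.subset_inter Set.inter_subset_left
        (Set.inter_subset_left.trans Metric.sphere_subset_closedBall))).trans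
        (hausdorffMeasure_sphere_inter_closedBall_le ht ht.le x x)
    have hRm : (μH[2] : Measure E3).real S ≤ 384 * R ^ 2 :=
      ENNReal.toReal_le_of_le_ofReal (by positivity) hSR
    have htm : (μH[2] : Measure E3).real S ≤ 384 * t ^ 2 :=
      ENNReal.toReal_le_of_le_ofReal (by positivity) hSt
    set A := (μH[2] : Measure E3).real S
    have hA0 : 0 ≤ A := measureReal_nonneg
    have hint : ∫ y in Metric.sphere x t, G y ∂μH[2] ≤ M * A := by
      rw [setIntegral_eq_of_subset_of_forall_sdiff_eq_zero
        Metric.isClosed_sphere.measurableSet (Set.inter_subset_left : S ⊆ _)]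
      · exact (le_abs_self _).trans (norm_setIntegral_le_of_norm_le_const
          (hSR.trans_lt ENNReal.ofReal_lt_top) fun y _ => hGM y)
      · intro y hy
        refine hGz y (lt_of_not_ge fun h => hy.2 ⟨hy.1, ?_⟩)
        rwa [mem_closedBall_zero_iff]
    have hA : A * (1 + t) ≤ 384 * (R + R ^ 2) * t := by
      have h1 : A ≤ 384 * (R * t) := by
        rcases le_total R t with h | h
        · nlinarith
        · nlinarith
      nlinarith
    rw [← div_eq_mul_inv, one_div_mul_eq_div, div_le_div_iff₀ ht (by linarith)]
    calc (∫ y in Metric.sphere x t, G y ∂μH[2]) * (1 + t) ≤ M * A * (1 + t) := by gcongr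
      _ ≤ (M + 1) * (A * (1 + t)) := by nlinarith [mul_nonneg hA0 (by linarith : 0 ≤ 1 + t)]
      _ ≤ (M + 1) * (384 * (R + R ^ 2) * t) := by gcongr
      _ = 384 * (M + 1) * (R + R ^ 2) * t := by ring
  · intro hx
    rw [setIntegral_eq_zero_of_forall_eq_zero, mul_zero]
    intro y hy
    refine hGz y ?_
    have h1 : ‖y - x‖ = t := by rw [← dist_eq_norm]; exact hy
    linarith [norm_sub_le y x]
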